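/- Let f : ℝ^n → ℝ be convex and lower semicontinuous, x ∈ ℝ^n, t ∈ ℝ, and define the Moreau envelope f̃^τ(x) = min_y { (1/(2τ))‖y − x‖² + f(y) }. Then the function φ(τ) = (f̃^τ(x) − t)τ − τ²/2 on τ > 0 is concave, and any maximizer τ* > 0 of φ over τ ≥ 0 satisfies f(prox_{τ* f}(x)) = t + τ*. -/

import Mathlib

theorem prox_subgrad {E : Type*} [NormedAddCommGroup E] [InnerProductSpace ℝ E] (f : E → ℝ)
    (hconv : ConvexOn ℝ Set.univ f) (x p : E) (τ : ℝ) (hτ : 0 < τ)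
    (hp : ∀ y, 1 / (2 * τ) * ‖p - x‖ ^ 2 + f p ≤ 1 / (2 * τ) * ‖y - x‖ ^ 2 + f y) (y : E) :
    inner ℝ (x - p) (y - p) ≤ τ * (f y - f p) := by
  have key : ∀ l : ℝ, 0 < l → l ≤ 1 →
      inner ℝ (x - p) (y - p) ≤ τ * (f y - f p) + l * (‖y - p‖ ^ 2 / 2) := by
    intro l hl hl1
    have h1 := hp (p + l • (y - p))
    have h2 : f (p + l • (y - p)) ≤ (1 - l) * f p + l * f y := by
      have := hconv.2 (Set.mem_univ p) (Set.mem_univ y) (by linarith : 0 ≤ 1 - l) hl.le (by ring)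
      have e : p + l • (y - p) = (1 - l) • p + l • y := by module
      rw [e]; simpa using this
    have h3 : ‖p + l • (y - p) - x‖ ^ 2
        = ‖p - x‖ ^ 2 - 2 * l * inner ℝ (x - p) (y - p) + l ^ 2 * ‖y - p‖ ^ 2 := by
      have e : p + l • (y - p) - x = l • (y - p) - (x - p) := by module
      rw [e, norm_sub_sq_real, inner_smul_left, norm_smul, real_inner_comm, norm_sub_rev x p]
      simp [mul_pow]
      ring
    rw [h3] at h1
    have h4 : 0 ≤ 1 / (2 * τ) * (- 2 * l * inner ℝ (x - p) (y - p) + l ^ 2 * ‖y - p‖ ^ 2)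
        + l * (f y - f p) := by nlinarith
    have h5 : 0 ≤ l * (τ * (f y - f p) + l * (‖y - p‖ ^ 2 / 2) - inner ℝ (x - p) (y - p)) := by
      have := mul_nonneg hτ.le h4
      have e : τ * (1 / (2 * τ) * (- 2 * l * inner ℝ (x - p) (y - p) + l ^ 2 * ‖y - p‖ ^ 2)
        + l * (f y - f p)) = l * (τ * (f y - f p) + l * (‖y - p‖ ^ 2 / 2)
          - inner ℝ (x - p) (y - p)) := by
        field_simp; ring
      rwa [e] at this
    have := nonneg_of_mul_nonneg_right h5 hl
    linarith
  by_contra! hc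
  set D := ‖y - p‖ ^ 2 / 2 with hD
  have hD0 : 0 ≤ D := by positivity
  set e := inner ℝ (x - p) (y - p) - τ * (f y - f p) with he
  have he0 : 0 < e := by linarith
  have h := key (min 1 (e / (2 * (D + 1)))) (by positivity) (min_le_left _ _)
  have h2 : min 1 (e / (2 * (D + 1))) * D ≤ e / (2 * (D + 1)) * (D + 1) :=
    mul_le_mul (min_le_right _ _) (by linarith) hD0 (by positivity)
  have h3 : e / (2 * (D + 1)) * (D + 1) = e / 2 := by field_simp
  linarith

/-- the dual objective `φ(τ) = (f̃^τ(x) − t)τ − τ²/2` built from the Moreau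
envelope is concave on `τ > 0`, and any maximizer `τ* > 0` of `φ` over `τ ≥ 0` satisfies
`f(prox_{τ* f}(x)) = t + τ*`. -/
theorem stmt_6 {n : ℕ} (f : EuclideanSpace ℝ (Fin n) → ℝ)
    (hconv : ConvexOn ℝ Set.univ f) (hlsc : LowerSemicontinuous f)
    (x : EuclideanSpace ℝ (Fin n)) (t : ℝ) (ht : t < f x)
    (env : ℝ → ℝ)
    (henv : ∀ τ > (0:ℝ), IsLeast {r : ℝ | ∃ y, r = 1 / (2 * τ) * ‖y - x‖ ^ 2 + f y} (env τ))
    (φ : ℝ → ℝ) (hφ : ∀ τ, φ τ = (env τ - t) * τ - τ ^ 2 / 2) :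
    ConcaveOn ℝ (Set.Ioi 0) φ ∧
      ∀ τstar : ℝ, 0 < τstar → (∀ τ > (0:ℝ), φ τ ≤ φ τstar) → (0:ℝ) ≤ φ τstar →
        ∀ p : EuclideanSpace ℝ (Fin n),
          (∀ y, 1 / (2 * τstar) * ‖p - x‖ ^ 2 + f p ≤ 1 / (2 * τstar) * ‖y - x‖ ^ 2 + f y) →
          f p = t + τstar := by
  have hle : ∀ τ > (0:ℝ), ∀ y, φ τ ≤ ‖y - x‖ ^ 2 / 2 + τ * (f y - t) - τ ^ 2 / 2 := by
    intro τ hτ y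
    have h := (henv τ hτ).2 ⟨y, rfl⟩
    have h2 := mul_le_mul_of_nonneg_right h hτ.le
    have e : (1 / (2 * τ) * ‖y - x‖ ^ 2 + f y) * τ = ‖y - x‖ ^ 2 / 2 + τ * f y := by
      field_simp
    rw [e] at h2
    rw [hφ]; linarith
  have heq : ∀ τ > (0:ℝ), ∀ p,
      (∀ y, 1 / (2 * τ) * ‖p - x‖ ^ 2 + f p ≤ 1 / (2 * τ) * ‖y - x‖ ^ 2 + f y) →
      φ τ = ‖p - x‖ ^ 2 / 2 + τ * (f p - t) - τ ^ 2 / 2 := by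
    intro τ hτ p hp
    obtain ⟨y, hy⟩ := (henv τ hτ).1
    have h : env τ = 1 / (2 * τ) * ‖p - x‖ ^ 2 + f p :=
      le_antisymm ((henv τ hτ).2 ⟨p, rfl⟩) (hy ▸ hp y)
    rw [hφ, h]; field_simp; ring
  have hex : ∀ τ > (0:ℝ), ∃ p,
      (∀ y, 1 / (2 * τ) * ‖p - x‖ ^ 2 + f p ≤ 1 / (2 * τ) * ‖y - x‖ ^ 2 + f y) := by
    intro τ hτ
    obtain ⟨p, hp⟩ := (henv τ hτ).1
    exact ⟨p, fun y => hp ▸ (henv τ hτ).2 ⟨y, rfl⟩⟩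
  refine ⟨⟨convex_Ioi 0, ?_⟩, ?_⟩
  · intro a ha b hb u v hu hv huv
    have hab : a * u + b * v > 0 := by
      have := (convex_Ioi (0:ℝ)) ha hb hu hv huv
      simp only [smul_eq_mul, Set.mem_Ioi] at this
      linarith
    simp only [smul_eq_mul]
    rw [show u * a + v * b = a * u + b * v by ring]
    obtain ⟨p, hp⟩ := hex _ hab
    rw [heq _ hab p hp]
    have h1 := mul_le_mul_of_nonneg_left (hle a ha p) hu
    have h2 := mul_le_mul_of_nonneg_left (hle b hb p) hv
    have hv' : v = 1 - u := by linarith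
    subst hv'
    nlinarith [mul_nonneg (mul_nonneg hu hv) (sq_nonneg (a - b))]
  · intro T hT hmax _ p hp
    set s := f p - t - T with hs
    set K := 2 * ‖x - p‖ / T with hK
    have hK0 : 0 ≤ K := by positivity
    have main : ∀ h : ℝ, -(T / 2) ≤ h → h * s ≤ h ^ 2 * (1 + K ^ 2) / 2 := by
      intro h hh
      have hτ : 0 < T + h := by linarith
      obtain ⟨y, hy⟩ := hex _ hτ
      have e1 := heq _ hτ y hy
      have e2 := heq _ hT p hp
      have m := hmax _ hτ
      have s1 := prox_subgrad f hconv x p T hT hp y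
      have s2 := prox_subgrad f hconv x y (T + h) hτ hy p
      have n1 : ‖y - x‖ ^ 2 = ‖p - x‖ ^ 2 - 2 * inner ℝ (x - p) (y - p) + ‖y - p‖ ^ 2 := by
        have e : y - x = (y - p) - (x - p) := by module
        rw [e, norm_sub_sq_real, real_inner_comm, norm_sub_rev x p]; ring
      have n2 : inner ℝ (x - y) (p - y) = ‖y - p‖ ^ 2 - inner ℝ (x - p) (y - p) := by
        have e : x - y = (x - p) - (y - p) := by module
        have e' : p - y = - (y - p) := by module
        rw [e, e', inner_neg_right, inner_sub_left, real_inner_self_eq_norm_sq]; ring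
      have cs := abs_le.1 (abs_real_inner_le_norm (x - p) (y - p))
      set d := ‖y - p‖ with hd
      have hd0 : 0 ≤ d := norm_nonneg _
      have hc : ‖x - p‖ = K * T / 2 := by rw [hK]; field_simp
      rw [hc] at cs
      rw [n2] at s2
      have hKd : 0 ≤ K * d := mul_nonneg hK0 hd0
      have l1 : -(K * d) ≤ f y - f p := by
        by_contra! hcon
        nlinarith [mul_lt_mul_of_pos_left hcon hT]
      have l2 : f y - f p ≤ K * d := by
        by_contra! hcon
        nlinarith [mul_lt_mul_of_pos_left hcon hτ, mul_nonneg hKd (by linarith : 0 ≤ h + T / 2)]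
      have l3 : -(d ^ 2 / 2 + h ^ 2 * K ^ 2 / 2) ≤ h * (f y - f p) := by
        have q : (f y - f p) ^ 2 ≤ (K * d) ^ 2 := sq_le_sq' l1 l2
        have q2 : |h * (f y - f p)| ≤ |h| * (K * d) := by
          rw [abs_mul]
          exact mul_le_mul_of_nonneg_left (abs_le.2 ⟨l1, l2⟩) (abs_nonneg h)
        have q3 := (abs_le.1 q2).1
        nlinarith [sq_nonneg (|h| * K - d), sq_abs h]
      rw [e1, e2, n1] at m
      have : f p = s + t + T := by rw [hs]; ring
      nlinarith
    have hs0 : s = 0 := by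
      have hP : 0 < 1 + K ^ 2 := by positivity
      rcases lt_trichotomy s 0 with hn | hz | hpos
      · exfalso
        set k := min (T / 2) (-s / (1 + K ^ 2)) with hk
        have hk0 : 0 < k := lt_min (by linarith) (div_pos (by linarith) hP)
        have m := main (-k) (by linarith [min_le_left (T / 2) (-s / (1 + K ^ 2))])
        have hk2 : k * (1 + K ^ 2) ≤ -s := (le_div_iff₀ hP).1 (min_le_right _ _)
        nlinarith [mul_le_mul_of_nonneg_left hk2 hk0.le, mul_pos hk0 (neg_pos.2 hn)]
      · exact hz
      · exfalso
        set k := s / (1 + K ^ 2) with hk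
        have hk0 : 0 < k := div_pos hpos hP
        have m := main k (by linarith)
        have hk2 : k * (1 + K ^ 2) = s := div_mul_cancel₀ _ hP.ne'
        nlinarith [mul_pos hk0 hpos]
    linarith
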